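/- arXiv:2006.07610 — 2 statements merged into one kernel-verified Lean document; each statement's English description precedes it below -/
import Mathlib

section
/- (Uniqueness theorem for sparse Fourier quasicrystals.) Let μ = Σ_λ μ(λ)δ_λ and ν = Σ_γ ν(γ)δ_γ be sparse Fourier quasicrystals on ℝ^d with supports Λ = {λ_n} and Γ = {γ_n}. If under some numbering λ_n − γ_n → 0 and μ(λ_n) − ν(γ_n) → 0 as n → ∞, then μ = ν. -/
open MeasureTheory Metric Filter Topology SchwartzMap
open scoped FourierTransform RealInnerProductSpace

noncomputable section

abbrev Ed (d : ℕ) := EuclideanSpace ℝ (Fin d)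

/-- A set is relatively dense if some radius `R` works: every ball of radius `R` meets it. -/
def IsRelativelyDense {d : ℕ} (A : Set (Ed d)) : Prop :=
  ∃ R : ℝ, ∀ x : Ed d, (Metric.ball x R ∩ A).Nonempty

/-- The set of ε-almost periods of a function. -/
def almostPeriods {d : ℕ} {F : Type*} [NormedAddCommGroup F] (f : Ed d → F) (ε : ℝ) :
    Set (Ed d) :=
  {τ | ∀ t : Ed d, ‖f (t + τ) - f t‖ < ε}

/-- Bohr almost periodic function on `ℝ^d`. -/
def IsBohrAP {d : ℕ} {F : Type*} [NormedAddCommGroup F] (f : Ed d → F) : Prop :=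
  Continuous f ∧ ∀ ε > (0 : ℝ), IsRelativelyDense (almostPeriods f ε)

/-- A sparse Fourier quasicrystal on `ℝ^d`: a discrete measure `μ = Σ c(λ)δ_λ` which belongs
to `S*(ℝ^d)` (via the tempered distribution `T` representing it), whose Fourier transform is
an atomic measure `μ̂ = Σ b(s)δ_s` with `|μ̂| ∈ S*(ℝ^d)`, and whose support meets every unit
ball in at most `N` points, uniformly. -/
structure SparseFQC (d : ℕ) where
  /-- masses of the measure: `μ = Σ_λ c(λ) δ_λ` -/
  c : Ed d → ℂ
  /-- the tempered distribution defined by `μ` (i.e. `μ ∈ S*(ℝ^d)`) -/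
  T : 𝓢(Ed d, ℂ) →L[ℂ] ℂ
  /-- masses of the Fourier transform: `μ̂ = Σ_s b(s) δ_s` -/
  b : Ed d → ℂ
  /-- the support of `μ` is discrete: every point of it is isolated -/
  discr : ∀ x ∈ Function.support c, ∃ ε > (0 : ℝ),
    ∀ y ∈ Function.support c, y ∈ Metric.ball x ε → y = x
  /-- `μ` is locally of finite total variation (it is a measure) -/
  loc : ∀ R : ℝ, Summable fun x : Metric.ball (0 : Ed d) R => ‖c x‖
  /-- `T` represents the measure `μ` -/
  temp : ∀ φ : 𝓢(Ed d, ℂ), HasCompactSupport (fun x => φ x) →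
    T φ = ∑' x : Ed d, c x * φ x
  /-- `μ̂` is atomic -/
  atomicB : (Function.support b).Countable
  /-- `μ̂ = Σ_s b(s) δ_s`, i.e. `μ(φ̂) = Σ_s b(s) φ(s)` -/
  hatT : ∀ φ : 𝓢(Ed d, ℂ),
    T (SchwartzMap.fourierTransformCLM ℂ φ) = ∑' y : Ed d, b y * φ y
  /-- `|μ̂| ∈ S*(ℝ^d)` -/
  hatTemp : ∀ φ : 𝓢(Ed d, ℂ), Summable fun y : Ed d => ‖b y‖ * ‖φ y‖
  /-- the numbers `#(supp μ ∩ B(x,1))` are uniformly bounded -/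
  sparse : ∃ N : ℕ, ∀ x : Ed d, (Function.support c ∩ Metric.ball x 1).encard ≤ N

/-- Simultaneous recurrence: weighted sums of distances of characters to `1` become small
along arbitrarily large integers. -/
lemma exists_ge_tsum_fourierChar_sub_one_lt {ι : Type*} {w : ι → ℝ} (hw : Summable w)
    (hw0 : ∀ i, 0 ≤ w i) (θ : ι → ℝ) (K : ℕ) {ε : ℝ} (hε : 0 < ε) :
    ∃ n ≥ K, ∑' i, w i * ‖(𝐞 (n * θ i) : ℂ) - 1‖ < ε := by
  let U := hyperfilter ℕ
  have hlim (i : ι) : ∃ L : Circle, Tendsto (fun n : ℕ => 𝐞 (n * θ i)) U (𝓝 L) :=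
    ⟨(U.map fun n : ℕ => 𝐞 (n * θ i)).lim, Ultrafilter.le_nhds_lim _⟩
  choose L hL using hlim
  have hlt : Tendsto (fun n : ℕ => ∑' i, w i * ‖(𝐞 (n * θ i) : ℂ) - L i‖) U
      (𝓝 (∑' i : ι, (0 : ℝ))) := by
    refine tendsto_tsum_of_dominated_convergence (bound := fun i => w i * 2) (hw.mul_right 2)
      (fun i => ?_) (Eventually.of_forall fun n i => ?_)
    · have h1 : Tendsto (fun n : ℕ => (𝐞 (n * θ i) : ℂ)) U (𝓝 (L i : ℂ)) :=
        (continuous_subtype_val.tendsto _).comp (hL i)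
      simpa using ((h1.sub_const (L i : ℂ)).norm).const_mul (w i)
    · rw [Real.norm_of_nonneg (mul_nonneg (hw0 i) (norm_nonneg _))]
      refine mul_le_mul_of_nonneg_left ((norm_sub_le _ _).trans ?_) (hw0 i)
      simp only [Circle.norm_coe]; norm_num
  rw [tsum_zero] at hlt
  have hsmall : ∀ᶠ n : ℕ in (U : Filter ℕ),
      ∑' i, w i * ‖(𝐞 (n * θ i) : ℂ) - L i‖ < ε / 2 :=
    hlt.eventually_lt_const (half_pos hε)
  obtain ⟨m, hm⟩ := hsmall.exists
  obtain ⟨n, hn, hnm⟩ :=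
    (hsmall.and ((eventually_ge_atTop (m + K)).filter_mono Nat.hyperfilter_le_atTop)).exists
  have hsum (k : ℕ) (z : ι → Circle) : Summable fun i => w i * ‖(𝐞 (k * θ i) : ℂ) - z i‖ := by
    refine (hw.mul_right 2).of_nonneg_of_le
      (fun i => mul_nonneg (hw0 i) (norm_nonneg _)) fun i => ?_
    refine mul_le_mul_of_nonneg_left ((norm_sub_le _ _).trans ?_) (hw0 i)
    simp only [Circle.norm_coe]; norm_num
  refine ⟨n - m, by omega, ?_⟩
  calc ∑' i, w i * ‖(𝐞 ((n - m : ℕ) * θ i) : ℂ) - 1‖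
      ≤ ∑' i, (w i * ‖(𝐞 (n * θ i) : ℂ) - L i‖ + w i * ‖(𝐞 (m * θ i) : ℂ) - L i‖) := by
        refine Summable.tsum_le_tsum (fun i => ?_) (by simpa using hsum (n - m) 1)
          ((hsum n L).add (hsum m L))
        rw [← mul_add]
        refine mul_le_mul_of_nonneg_left ?_ (hw0 i)
        have hmul : (𝐞 (n * θ i) : ℂ) = 𝐞 ((n - m : ℕ) * θ i) * 𝐞 (m * θ i) := by
          rw [← Circle.coe_mul, ← AddChar.map_add_eq_mul, ← add_mul, ← Nat.cast_add,
            Nat.sub_add_cancel (by omega)]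
        have hnorm : ‖(𝐞 ((n - m : ℕ) * θ i) : ℂ) - 1‖
            = ‖(𝐞 (n * θ i) : ℂ) - 𝐞 (m * θ i)‖ := by
          rw [hmul, ← sub_one_mul, norm_mul, Circle.norm_coe, mul_one]
        rw [hnorm, ← norm_sub_rev (L i : ℂ) (𝐞 (m * θ i) : ℂ)]
        exact norm_sub_le_norm_sub_add_norm_sub _ _ _
    _ < ε := by
        rw [(hsum n L).tsum_add (hsum m L)]
        linarith

lemma SchwartzMap.fourierInv_compSubConstCLM {d : ℕ} (φ : 𝓢(Ed d, ℂ)) (x y : Ed d) :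
    (𝓕⁻ (φ.compSubConstCLM ℂ x)) y = (𝐞 ⟪x, y⟫ : ℂ) * (𝓕⁻ φ) y := by
  rw [SchwartzMap.fourierInv_coe, SchwartzMap.fourierInv_coe, Real.fourierInv_eq,
    Real.fourierInv_eq, ← integral_const_mul,
    ← integral_sub_right_eq_self (fun v => (𝐞 ⟪x, y⟫ : ℂ) * (𝐞 ⟪v, y⟫ • φ v)) x]
  refine integral_congr_ae (Eventually.of_forall fun v => ?_)
  simp only [SchwartzMap.compSubConstCLM_apply, Circle.smul_def, smul_eq_mul]
  rw [← mul_assoc, ← Circle.coe_mul, ← AddChar.map_add_eq_mul, ← inner_add_left,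
    add_sub_cancel]

namespace SparseFQC

variable {d : ℕ}

lemma T_eq_tsum_fourierInv (μ : SparseFQC d) (φ : 𝓢(Ed d, ℂ)) :
    μ.T φ = ∑' y, μ.b y * (𝓕⁻ φ) y := by
  rw [← μ.hatT, SchwartzMap.fourierTransformCLM_apply, FourierTransform.fourier_fourierInv_eq]

lemma norm_T_compSubConstCLM_sub_le (μ : SparseFQC d) (φ : 𝓢(Ed d, ℂ)) (x : Ed d) :
    ‖μ.T (φ.compSubConstCLM ℂ x) - μ.T φ‖ ≤
      ∑' y, ‖μ.b y‖ * ‖(𝓕⁻ φ) y‖ * ‖(𝐞 ⟪x, y⟫ : ℂ) - 1‖ := by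
  have h1 (ψ : 𝓢(Ed d, ℂ)) : Summable fun y => μ.b y * ψ y :=
    Summable.of_norm (by simpa only [norm_mul] using μ.hatTemp ψ)
  rw [μ.T_eq_tsum_fourierInv, μ.T_eq_tsum_fourierInv, ← (h1 _).tsum_sub (h1 _)]
  have h2 (y : Ed d) : ‖μ.b y * (𝓕⁻ (φ.compSubConstCLM ℂ x)) y - μ.b y * (𝓕⁻ φ) y‖ =
      ‖μ.b y‖ * ‖(𝓕⁻ φ) y‖ * ‖(𝐞 ⟪x, y⟫ : ℂ) - 1‖ := by
    rw [SchwartzMap.fourierInv_compSubConstCLM, ← norm_mul, ← norm_mul]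
    congr 1
    ring
  simp_rw [← h2]
  exact norm_tsum_le_tsum_norm ((h1 _).sub (h1 _)).norm

lemma tsum_mul_eq_sum (μ : SparseFQC d) {l : ℕ → Ed d} (hl : Function.Injective l)
    (hrl : Set.range l = Function.support μ.c) (f : Ed d → ℂ) (J : Finset ℕ)
    (h1 : ∀ n ∈ J, f (l n) = 1) (h0 : ∀ n ∉ J, f (l n) = 0) :
    ∑' y, μ.c y * f y = ∑ n ∈ J, μ.c (l n) := by
  have hs : (Function.support fun y => μ.c y * f y) ⊆ Set.range l := by
    rw [hrl]
    intro y hy hc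
    exact hy (by simp [hc])
  rw [← hl.tsum_eq hs, tsum_eq_sum (s := J) fun n hn => by simp [h0 n hn]]
  exact Finset.sum_congr rfl fun n hn => by simp [h1 n hn]

/-- The smooth bump equal to `1` on `closedBall a r` and to `0` off `ball a R`. -/
def bump (a : Ed d) (r R : ℝ) (hr : 0 < r) (hR : r < R) : 𝓢(Ed d, ℂ) :=
  HasCompactSupport.toSchwartzMap
    (f := Complex.ofRealCLM ∘ (⟨r, R, hr, hR⟩ : ContDiffBump a))
    ((ContDiffBump.hasCompactSupport _).comp_left (by simp))
    (Complex.ofRealCLM.contDiff.comp (ContDiffBump.contDiff _))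

section bump

variable {a : Ed d} {r R : ℝ} {hr : 0 < r} {hR : r < R}

lemma bump_eq_one {y : Ed d} (h : dist y a ≤ r) : bump a r R hr hR y = 1 := by
  have := (⟨r, R, hr, hR⟩ : ContDiffBump a).one_of_mem_closedBall (x := y) h
  simp [bump, this]

lemma bump_eq_zero {y : Ed d} (h : R ≤ dist y a) : bump a r R hr hR y = 0 := by
  have := (⟨r, R, hr, hR⟩ : ContDiffBump a).zero_of_le_dist (x := y) h
  simp [bump, this]

lemma hasCompactSupport_bump_comp (x : Ed d) :
    HasCompactSupport fun y => (bump a r R hr hR).compSubConstCLM ℂ x y := by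
  refine HasCompactSupport.of_support_subset_isCompact
    (isCompact_closedBall (a + x) R) fun y hy => ?_
  by_contra h
  refine hy (bump_eq_zero ?_)
  rw [mem_closedBall, not_le, dist_eq_norm] at h
  rw [dist_eq_norm, sub_sub, add_comm x a]
  exact h.le

lemma T_bump_comp (μ : SparseFQC d) {l : ℕ → Ed d} (hl : Function.Injective l)
    (hrl : Set.range l = Function.support μ.c) (x : Ed d) (J : Finset ℕ)
    (h1 : ∀ n ∈ J, dist (l n) (a + x) ≤ r) (h0 : ∀ n ∉ J, R ≤ dist (l n) (a + x)) :
    μ.T ((bump a r R hr hR).compSubConstCLM ℂ x) = ∑ n ∈ J, μ.c (l n) := by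
  have hd (y : Ed d) : dist (y - x) a = dist y (a + x) := by
    rw [dist_eq_norm, dist_eq_norm, sub_sub, add_comm x a]
  rw [μ.temp _ (hasCompactSupport_bump_comp x)]
  refine μ.tsum_mul_eq_sum hl hrl _ J (fun n hn => ?_) fun n hn => ?_
  · exact bump_eq_one ((hd _).trans_le (h1 n hn))
  · exact bump_eq_zero ((h0 n hn).trans_eq (hd _).symm)

lemma T_bump_of_isolated (μ : SparseFQC d)
    (h : ∀ y ∈ Function.support μ.c, y ≠ a → R ≤ dist y a) :
    μ.T (bump a r R hr hR) = μ.c a := by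
  rw [μ.temp _ (by simpa using hasCompactSupport_bump_comp (hr := hr) (hR := hR) (a := a) 0),
    tsum_eq_single a]
  · rw [bump_eq_one (by simpa using hr.le), mul_one]
  · intro y hy
    by_cases hc : μ.c y = 0
    · simp [hc]
    · rw [bump_eq_zero (h y hc hy), mul_zero]

end bump

end SparseFQC

/-- If a set has fewer points than there are shells, then some shell misses it. -/
lemma exists_shell_disjoint {X : Type*} (S : Set X) (f : X → ℝ) {M : ℕ} (hS : S.encard < M)
    {ρ : ℕ → ℝ} (hρ : Monotone ρ) :
    ∃ i < M, ∀ p ∈ S, f p ≤ ρ i ∨ ρ (i + 1) < f p := by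
  by_contra! h
  choose p hpS hp using fun i : Fin M => h i i.2
  have hlt {i j : Fin M} (hij : i < j) : f (p i) < f (p j) :=
    ((hp i).2.trans (hρ hij)).trans_lt (hp j).1
  have hinj : Function.Injective p :=
    (show StrictMono (f ∘ p) from fun _ _ => hlt).injective.of_comp
  have hsub : Set.range p ⊆ S := Set.range_subset_iff.2 hpS
  have := (Set.encard_le_encard hsub).trans_lt hS
  rw [← Set.image_univ, hinj.encard_image] at this
  simp at this

/-- Uniqueness theorem for sparse Fourier quasicrystals: if, under an appropriate numbering
of their supports, `λ_n − γ_n → 0` and `μ(λ_n) − ν(γ_n) → 0`, then `μ = ν`. -/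
theorem sparse_FQC_unique {d : ℕ} (μ ν : SparseFQC d) (l g : ℕ → Ed d)
    (hl : Function.Injective l) (hg : Function.Injective g)
    (hrl : Set.range l = Function.support μ.c) (hrg : Set.range g = Function.support ν.c)
    (hpts : Tendsto (fun n => l n - g n) atTop (𝓝 0))
    (hmass : Tendsto (fun n => μ.c (l n) - ν.c (g n)) atTop (𝓝 0)) :
    μ.c = ν.c := by
  funext a
  by_contra hne
  set ε := ‖μ.c a - ν.c a‖ with hε_def
  have hε : 0 < ε := norm_pos_iff.2 (sub_ne_zero.2 hne)
  obtain ⟨N₁, hN₁⟩ := μ.sparse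
  obtain ⟨N₂, hN₂⟩ := ν.sparse
  set S : Set (Ed d) := Function.support μ.c ∪ Function.support ν.c with hS_def
  have hScard (x : Ed d) : (S ∩ ball x 1).encard ≤ (N₁ + N₂ : ℕ) := by
    rw [hS_def, Set.union_inter_distrib_right]
    refine (Set.encard_union_le _ _).trans ?_
    push_cast
    exact add_le_add (hN₁ x) (hN₂ x)
  obtain ⟨r, hr0, hr1, hr⟩ : ∃ r : ℝ, 0 < r ∧ r < 1 ∧ ∀ y ∈ S, y ≠ a → r ≤ dist y a := by
    have hfin : ((S ∩ ball a 1) \ {a}).Finite :=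
      (Set.finite_of_encard_le_coe (hScard a)).sdiff
    obtain ⟨r, hr0, hr⟩ := Metric.isOpen_iff.1 hfin.isClosed.isOpen_compl a (by simp)
    refine ⟨min r (1 / 2), by positivity, (min_le_right _ _).trans_lt (by norm_num),
      fun y hy hya => ?_⟩
    by_contra! hlt
    refine hr (mem_ball.2 (hlt.trans_le (min_le_left _ _))) ⟨⟨hy, ?_⟩, hya⟩
    exact mem_ball.2 ((hlt.trans_le (min_le_right _ _)).trans (by norm_num))
  set M := N₁ + N₂ + 1 with hM
  set δ := r / (M + 1) with hδ_def
  have hδ : 0 < δ := by positivity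
  let ρ : ℕ → ℝ := fun i => (i + 1) * δ
  have hρs (i : ℕ) : ρ (i + 1) = ρ i + δ := by simp only [ρ]; push_cast; ring
  have hρlt (i : ℕ) : ρ i < ρ (i + 1) := by rw [hρs]; linarith
  have hρ0 (i : ℕ) : 0 < ρ i := by positivity
  have hρmono : Monotone ρ := monotone_nat_of_le_succ fun i => (hρlt i).le
  have hρr {i : ℕ} (hi : i < M) : ρ (i + 1) ≤ r := by
    have h1 : ρ (i + 1) ≤ ρ M := hρmono hi
    have h2 : ρ M = r := by simp only [ρ, hδ_def]; field_simp
    exact h1.trans_eq h2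
  let φ : ℕ → 𝓢(Ed d, ℂ) := fun i => SparseFQC.bump a (ρ i) (ρ (i + 1)) (hρ0 i) (hρlt i)
  let u : ℕ → Ed d → ℝ := fun i y => (‖μ.b y‖ + ‖ν.b y‖) * ‖(𝓕⁻ (φ i)) y‖
  have hu0 (i : ℕ) (y : Ed d) : 0 ≤ u i y := by positivity
  have hu (i : ℕ) : Summable (u i) := by
    simpa only [u, add_mul] using (μ.hatTemp (𝓕⁻ (φ i))).add (ν.hatTemp (𝓕⁻ (φ i)))
  let w : Ed d → ℝ := fun y => ∑ i ∈ Finset.range M, u i y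
  have hw0 (y : Ed d) : 0 ≤ w y := Finset.sum_nonneg fun i _ => hu0 i y
  have hw : Summable w := summable_sum fun i _ => hu i
  set η := ε / (2 * (N₁ + 1)) with hη_def
  have hη : 0 < η := by positivity
  obtain ⟨n₀, hn₀⟩ : ∃ n₀ : ℕ, ∀ n ≥ n₀, dist (l n) (g n) < δ ∧ ‖μ.c (l n) - ν.c (g n)‖ < η := by
    have h1 := (tendsto_zero_iff_norm_tendsto_zero.1 hpts).eventually_lt_const hδ
    have h2 := (tendsto_zero_iff_norm_tendsto_zero.1 hmass).eventually_lt_const hη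
    simpa only [dist_eq_norm] using eventually_atTop.1 (h1.and h2)
  set v : Ed d := l 0 - l 1
  have hv : 0 < ‖v‖ := norm_pos_iff.2 (sub_ne_zero.2 (hl.ne (by norm_num)))
  set B := ∑ n ∈ Finset.range n₀, (dist (l n) a + dist (g n) a) with hB
  obtain ⟨K, hK⟩ := exists_nat_ge ((B + 1) / ‖v‖)
  obtain ⟨k, hkK, hk⟩ := exists_ge_tsum_fourierChar_sub_one_lt hw hw0 (fun y => ⟪v, y⟫) K
    (half_pos hε)
  set x : Ed d := (k : ℝ) • v with hx
  have hxB : B + 1 ≤ ‖x‖ := by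
    rw [hx, norm_smul, Real.norm_natCast]
    exact ((div_le_iff₀ hv).1 hK).trans (by gcongr)
  have hinner (y : Ed d) : (k : ℝ) * ⟪v, y⟫ = ⟪x, y⟫ := by rw [hx, real_inner_smul_left]
  simp_rw [hinner] at hk
  have hfar {n : ℕ} (hn : n < n₀) {p : Ed d} (hp : p = l n ∨ p = g n) :
      1 ≤ dist p (a + x) := by
    have h1 : dist (l n) a + dist (g n) a ≤ B :=
      Finset.single_le_sum (f := fun n => dist (l n) a + dist (g n) a)
        (fun _ _ => by positivity) (Finset.mem_range.2 hn)
    have h2 : dist p a ≤ B := by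
      rcases hp with rfl | rfl <;> linarith [dist_nonneg (x := l n) (y := a),
        dist_nonneg (x := g n) (y := a)]
    have h3 := dist_triangle_left a (a + x) p
    rw [dist_self_add_right] at h3
    linarith
  obtain ⟨i, hi, hshell⟩ := exists_shell_disjoint (S ∩ ball (a + x) 1) (dist · (a + x))
    (M := M) ((hScard _).trans_lt (by rw [hM]; exact_mod_cast Nat.lt_succ_self _)) hρmono
  have hdich {p : Ed d} (hp : p ∈ S) :
      dist p (a + x) ≤ ρ i ∨ ρ (i + 1) < dist p (a + x) := by
    by_cases hb : p ∈ ball (a + x) 1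
    · exact hshell p ⟨hp, hb⟩
    · rw [mem_ball, not_lt] at hb
      exact Or.inr (((hρr hi).trans_lt hr1).trans_le hb)
  have hlS (n : ℕ) : l n ∈ S := Or.inl (hrl ▸ Set.mem_range_self n)
  have hgS (n : ℕ) : g n ∈ S := Or.inr (hrg ▸ Set.mem_range_self n)
  have hρ1 : ρ i < 1 := ((hρlt i).trans_le (hρr hi)).trans hr1
  have hlarge {n : ℕ} (h : dist (l n) (a + x) ≤ ρ i ∨ dist (g n) (a + x) ≤ ρ i) : n₀ ≤ n := by
    by_contra! hn
    rcases h with h | h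
    · linarith [hfar hn (Or.inl rfl)]
    · linarith [hfar hn (Or.inr rfl)]
  have hiff (n : ℕ) : dist (l n) (a + x) ≤ ρ i ↔ dist (g n) (a + x) ≤ ρ i := by
    constructor
    · intro h
      refine (hdich (hgS n)).resolve_right ?_
      have := (hn₀ n (hlarge (Or.inl h))).1
      rw [hρs]
      linarith [dist_triangle_left (g n) (a + x) (l n)]
    · intro h
      refine (hdich (hlS n)).resolve_right ?_
      have := (hn₀ n (hlarge (Or.inr h))).1
      rw [hρs]
      linarith [dist_triangle (l n) (g n) (a + x)]
  set J' : Set ℕ := {n | dist (l n) (a + x) ≤ ρ i} with hJ'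
  have hJcard : J'.encard ≤ N₁ := by
    rw [← hl.encard_image]
    refine (Set.encard_le_encard ?_).trans (hN₁ (a + x))
    rintro _ ⟨n, hn, rfl⟩
    exact ⟨hrl ▸ Set.mem_range_self n, mem_ball.2 (lt_of_le_of_lt hn hρ1)⟩
  have hJfin : J'.Finite := Set.finite_of_encard_le_coe hJcard
  set J := hJfin.toFinset with hJ
  have hmem (n : ℕ) : n ∈ J ↔ dist (l n) (a + x) ≤ ρ i := by simp [hJ, hJ']
  have hJN : J.card ≤ N₁ := by
    rw [hJfin.encard_eq_coe_toFinset_card] at hJcard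
    exact_mod_cast hJcard
  have hμx : μ.T ((φ i).compSubConstCLM ℂ x) = ∑ n ∈ J, μ.c (l n) :=
    μ.T_bump_comp hl hrl x J (fun n hn => (hmem n).1 hn)
      fun n hn => ((hdich (hlS n)).resolve_left fun h => hn ((hmem n).2 h)).le
  have hνx : ν.T ((φ i).compSubConstCLM ℂ x) = ∑ n ∈ J, ν.c (g n) :=
    ν.T_bump_comp hg hrg x J (fun n hn => (hiff n).1 ((hmem n).1 hn))
      fun n hn => ((hdich (hgS n)).resolve_left fun h => hn ((hmem n).2 ((hiff n).2 h))).le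
  have hμ : μ.T (φ i) = μ.c a :=
    μ.T_bump_of_isolated fun y hy hya => (hρr hi).trans (hr y (Or.inl hy) hya)
  have hν : ν.T (φ i) = ν.c a :=
    ν.T_bump_of_isolated fun y hy hya => (hρr hi).trans (hr y (Or.inr hy) hya)
  have hμap := μ.norm_T_compSubConstCLM_sub_le (φ i) x
  have hνap := ν.norm_T_compSubConstCLM_sub_le (φ i) x
  have hsum {f : Ed d → ℝ} (hf : Summable f) (hf0 : ∀ y, 0 ≤ f y) :
      Summable fun y => f y * ‖(𝐞 ⟪x, y⟫ : ℂ) - 1‖ := by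
    refine (hf.mul_right 2).of_nonneg_of_le (fun y => mul_nonneg (hf0 y) (norm_nonneg _))
      fun y => mul_le_mul_of_nonneg_left ((norm_sub_le _ _).trans ?_) (hf0 y)
    simp only [Circle.norm_coe]; norm_num
  have hap : ‖μ.T ((φ i).compSubConstCLM ℂ x) - μ.T (φ i)‖ +
      ‖ν.T ((φ i).compSubConstCLM ℂ x) - ν.T (φ i)‖ < ε / 2 := by
    refine ((add_le_add hμap hνap).trans ?_).trans_lt hk
    rw [← (hsum (μ.hatTemp _) fun y => by positivity).tsum_add
      (hsum (ν.hatTemp _) fun y => by positivity)]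
    simp_rw [← add_mul]
    exact Summable.tsum_le_tsum (fun y => mul_le_mul_of_nonneg_right
      (Finset.single_le_sum (f := fun i => u i y) (fun i _ => hu0 i y) (Finset.mem_range.2 hi))
      (norm_nonneg _)) (hsum (hu i) (hu0 i)) (hsum hw hw0)
  have hmain : ‖μ.T ((φ i).compSubConstCLM ℂ x) - ν.T ((φ i).compSubConstCLM ℂ x)‖ ≤ ε / 2 := by
    rw [hμx, hνx, ← Finset.sum_sub_distrib]
    calc ‖∑ n ∈ J, (μ.c (l n) - ν.c (g n))‖ ≤ ∑ n ∈ J, η :=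
          norm_sum_le_of_le _ fun n hn => (hn₀ n (hlarge (Or.inl ((hmem n).1 hn)))).2.le
      _ = J.card * η := by rw [Finset.sum_const, nsmul_eq_mul]
      _ ≤ (N₁ + 1) * η := by
          gcongr
          exact_mod_cast hJN.trans (Nat.le_succ _)
      _ = ε / 2 := by rw [hη_def]; field_simp
  have htri : ε ≤ ‖μ.T ((φ i).compSubConstCLM ℂ x) - μ.T (φ i)‖ +
      ‖ν.T ((φ i).compSubConstCLM ℂ x) - ν.T (φ i)‖ +
      ‖μ.T ((φ i).compSubConstCLM ℂ x) - ν.T ((φ i).compSubConstCLM ℂ x)‖ := by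
    rw [hε_def, ← hμ, ← hν]
    set A := μ.T ((φ i).compSubConstCLM ℂ x)
    set C := ν.T ((φ i).compSubConstCLM ℂ x)
    have h1 : μ.T (φ i) - ν.T (φ i) = -(A - μ.T (φ i)) + (C - ν.T (φ i)) + (A - C) := by ring
    rw [h1]
    refine (norm_add₃_le).trans ?_
    rw [norm_neg]
  linarith
end
end

section
/- (Uniqueness via spectra.) Let μ, ν be Fourier quasicrystals on ℝ^d whose spectra Λ̃ = supp μ̂ and Γ̃ = supp ν̂ are uniformly sparse: sup_y #(Λ̃ ∩ B(y,1)) < ∞ and sup_y #(Γ̃ ∩ B(y,1)) < ∞. If under some numbering Λ̃ = {λ_n}, Γ̃ = {γ_n}, one has λ_n − γ_n → 0 and μ̂(λ_n) − ν̂(γ_n) → 0 as n → ∞, then μ = ν. -/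
open MeasureTheory Metric Filter Topology SchwartzMap
open scoped FourierTransform RealInnerProductSpace

noncomputable section

/-- A Fourier quasicrystal on `ℝ^d`: a discrete measure `μ = Σ c(λ)δ_λ` with `μ ∈ S*(ℝ^d)`
and `|μ| ∈ S*(ℝ^d)`, whose Fourier transform is a discrete measure `μ̂ = Σ b(s)δ_s` with
`|μ̂| ∈ S*(ℝ^d)`. -/
structure FQC (d : ℕ) where
  /-- masses of the measure `μ = Σ_λ c(λ) δ_λ` -/
  c : Ed d → ℂ
  /-- the tempered distribution defined by `μ` (i.e. `μ ∈ S*(ℝ^d)`) -/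
  T : 𝓢(Ed d, ℂ) →L[ℂ] ℂ
  /-- masses of the Fourier transform `μ̂ = Σ_s b(s) δ_s` -/
  b : Ed d → ℂ
  /-- the support of `μ` is discrete -/
  discrC : ∀ x ∈ Function.support c, ∃ ε > (0 : ℝ),
    ∀ y ∈ Function.support c, y ∈ Metric.ball x ε → y = x
  /-- the support of `μ̂` (the spectrum) is discrete -/
  discrB : ∀ x ∈ Function.support b, ∃ ε > (0 : ℝ),
    ∀ y ∈ Function.support b, y ∈ Metric.ball x ε → y = x
  /-- `|μ| ∈ S*(ℝ^d)` -/
  tempAbs : ∀ φ : 𝓢(Ed d, ℂ), Summable fun x : Ed d => ‖c x‖ * ‖φ x‖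
  /-- `T` represents `μ` -/
  temp : ∀ φ : 𝓢(Ed d, ℂ), T φ = ∑' x : Ed d, c x * φ x
  /-- `μ̂ = Σ_s b(s) δ_s`, i.e. `μ(φ̂) = Σ_s b(s) φ(s)` -/
  hatT : ∀ φ : 𝓢(Ed d, ℂ),
    T (SchwartzMap.fourierTransformCLM ℂ φ) = ∑' y : Ed d, b y * φ y
  /-- `|μ̂| ∈ S*(ℝ^d)` -/
  hatTemp : ∀ φ : 𝓢(Ed d, ℂ), Summable fun y : Ed d => ‖b y‖ * ‖φ y‖

/-- Along some filter of integers tending to infinity, all the powers of the characters of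
frequency `v` tend to `1` simultaneously. -/
theorem exists_filter_tendsto_fourierChar_pow {d : ℕ} (v : Ed d) :
    ∃ F : Filter ℕ, F.NeBot ∧ F ≤ atTop ∧
      ∀ x : Ed d, Tendsto (fun k : ℕ => (𝐞 ⟪v, x⟫) ^ k) F (𝓝 (1 : Circle)) := by
  let u : Ed d → Circle := fun x => 𝐞 ⟪v, x⟫
  have h : MapClusterPt 1 atTop (u ^ · : ℕ → (Ed d → Circle)) := mapClusterPt_one_atTop_pow u
  refine ⟨comap (u ^ · : ℕ → (Ed d → Circle)) (𝓝 1) ⊓ atTop, ?_, inf_le_right, fun x => ?_⟩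
  · rw [neBot_inf_comap_iff_map']
    exact h
  · have h1 : Tendsto (u ^ · : ℕ → (Ed d → Circle))
        (comap (u ^ · : ℕ → (Ed d → Circle)) (𝓝 1) ⊓ atTop) (𝓝 1) :=
      tendsto_comap.mono_left inf_le_left
    exact (tendsto_pi_nhds.1 h1) x

theorem fourier_compSubConstCLM {d : ℕ} (φ : 𝓢(Ed d, ℂ)) (a x : Ed d) :
    𝓕 (φ.compSubConstCLM ℂ a) x = (𝐞 (-⟪a, x⟫) : ℂ) * 𝓕 φ x := by
  have h := congrFun (VectorFourier.fourierIntegral_comp_add_right Real.fourierChar volume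
    (innerₗ (Ed d)) (φ : Ed d → ℂ) (-a)) x
  rw [SchwartzMap.fourier_coe, SchwartzMap.fourier_coe]
  simpa [Circle.smul_def, Function.comp_def, ← sub_eq_add_neg] using! h

/-- Recurrence of the Fourier transform of a quasicrystal under translations. -/
theorem FQC.tendsto_tsum_translate {d : ℕ} (μ : FQC d) (v : Ed d) {F : Filter ℕ}
    (hF : ∀ x : Ed d, Tendsto (fun k : ℕ => (𝐞 ⟪v, x⟫) ^ k) F (𝓝 (1 : Circle)))
    (φ : 𝓢(Ed d, ℂ)) :
    Tendsto (fun k : ℕ => ∑' y : Ed d, μ.b y * φ (y - k • v)) F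
      (𝓝 (∑' y : Ed d, μ.b y * φ y)) := by
  have e1 : ∀ ψ : 𝓢(Ed d, ℂ), ∑' y : Ed d, μ.b y * ψ y = ∑' x : Ed d, μ.c x * 𝓕 ψ x := by
    intro ψ
    rw [← μ.hatT, μ.temp]
    rfl
  have e2 : ∀ k : ℕ, ∑' y : Ed d, μ.b y * φ (y - k • v)
      = ∑' x : Ed d, μ.c x * ((((𝐞 ⟪v, x⟫) ^ k)⁻¹ : Circle) * 𝓕 φ x) := by
    intro k
    rw [show (∑' y : Ed d, μ.b y * φ (y - k • v))
      = ∑' y : Ed d, μ.b y * (φ.compSubConstCLM ℂ (k • v)) y from rfl, e1]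
    refine tsum_congr fun x => ?_
    rw [fourier_compSubConstCLM, AddChar.map_neg_eq_inv, ← Nat.cast_smul_eq_nsmul ℝ,
      real_inner_smul_left, ← nsmul_eq_mul, AddChar.map_nsmul_eq_pow]
  simp_rw [e2, e1]
  refine tendsto_tsum_of_dominated_convergence (μ.tempAbs (𝓕 φ)) (fun x => ?_)
    (Eventually.of_forall fun k x => ?_)
  · have h : Tendsto (fun k : ℕ => ((((𝐞 ⟪v, x⟫) ^ k)⁻¹ : Circle) : ℂ)) F (𝓝 1) := by
      have h1 := (continuous_subtype_val.tendsto _).comp (hF x).inv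
      simpa using! h1
    simpa using (h.mul_const (𝓕 φ x)).const_mul (μ.c x)
  · rw [norm_mul, norm_mul, Circle.norm_coe, one_mul]

theorem exists_schwartz_bump {d : ℕ} (p : Ed d) {a b : ℝ} (ha : 0 < a) (hab : a < b) :
    ∃ φ : 𝓢(Ed d, ℂ), (∀ x, dist x p ≤ a → φ x = 1) ∧ (∀ x, b ≤ dist x p → φ x = 0) ∧
      ∀ x, ‖φ x‖ ≤ 1 := by
  let f : ContDiffBump p := ⟨a, b, ha, hab⟩
  have hf : HasCompactSupport fun x => (f x : ℂ) :=
    f.hasCompactSupport.comp_left (g := fun t : ℝ => (t : ℂ)) Complex.ofReal_zero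
  have hf' : ContDiff ℝ (⊤ : ℕ∞) fun x => (f x : ℂ) :=
    Complex.ofRealCLM.contDiff.comp f.contDiff
  have hval : ∀ x, hf.toSchwartzMap hf' x = (f x : ℂ) := fun _ => rfl
  refine ⟨hf.toSchwartzMap hf', fun x hx => ?_, fun x hx => ?_, fun x => ?_⟩
  · simp [hval, f.one_of_mem_closedBall (show x ∈ closedBall p f.rIn from hx)]
  · simp [hval, f.zero_of_le_dist (show f.rOut ≤ dist x p from hx)]
  · simpa [hval, abs_of_nonneg f.nonneg] using f.le_one

theorem FQC.summable_b_mul_translate {d : ℕ} (μ : FQC d) (φ : 𝓢(Ed d, ℂ)) (τ : Ed d) :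
    Summable fun y : Ed d => μ.b y * φ (y - τ) := by
  refine Summable.of_norm ?_
  simpa only [norm_mul, SchwartzMap.compSubConstCLM_apply]
    using μ.hatTemp (φ.compSubConstCLM ℂ τ)

/-- The masses of a discrete measure are recovered by testing against shrinking bumps. -/
theorem exists_seq_schwartz_tendsto_mass {d : ℕ} (p : Ed d) :
    ∃ φ : ℕ → 𝓢(Ed d, ℂ), ∀ c : Ed d → ℂ,
      (∀ ψ : 𝓢(Ed d, ℂ), Summable fun x : Ed d => ‖c x‖ * ‖ψ x‖) →
      Tendsto (fun n => ∑' x : Ed d, c x * φ n x) atTop (𝓝 (c p)) := by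
  have hpos : ∀ n : ℕ, (0 : ℝ) < 1 / ((n : ℝ) + 1) := fun n => by positivity
  choose φ h1 h0 hle using fun n : ℕ =>
    exists_schwartz_bump p (half_pos (hpos n)) (half_lt_self (hpos n))
  obtain ⟨ψ, g1, -, -⟩ := exists_schwartz_bump p (a := 1) (b := 2) one_pos one_lt_two
  refine ⟨φ, fun c hc => ?_⟩
  classical
  have e : c p = ∑' x : Ed d, if x = p then c x else 0 := by simp
  rw [e]
  refine tendsto_tsum_of_dominated_convergence (hc ψ) (fun x => ?_)
    (Eventually.of_forall fun n x => ?_)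
  · split_ifs with hx
    · refine tendsto_const_nhds.congr fun n => ?_
      rw [h1 n x (by rw [hx, dist_self]; exact (half_pos (hpos n)).le), mul_one]
    · refine tendsto_const_nhds.congr' ?_
      have hd : 0 < dist x p := dist_pos.2 hx
      filter_upwards [(tendsto_one_div_add_atTop_nhds_zero_nat (𝕜 := ℝ)).eventually_lt_const hd]
        with n hn
      rw [h0 n x hn.le, mul_zero]
  · rw [norm_mul]
    gcongr
    rcases le_or_gt (dist x p) 1 with hx | hx
    · rw [g1 x hx, norm_one]
      exact hle n x
    · rw [h0 n x, norm_zero]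
      · exact norm_nonneg _
      · refine le_trans ?_ hx.le
        rw [div_le_one (by positivity)]
        linarith [(Nat.cast_nonneg n : (0 : ℝ) ≤ n)]

theorem masses_eq_of_forall_tsum_eq {d : ℕ} {c₁ c₂ : Ed d → ℂ}
    (h₁ : ∀ ψ : 𝓢(Ed d, ℂ), Summable fun x : Ed d => ‖c₁ x‖ * ‖ψ x‖)
    (h₂ : ∀ ψ : 𝓢(Ed d, ℂ), Summable fun x : Ed d => ‖c₂ x‖ * ‖ψ x‖)
    (h : ∀ ψ : 𝓢(Ed d, ℂ), ∑' x : Ed d, c₁ x * ψ x = ∑' x : Ed d, c₂ x * ψ x) :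
    c₁ = c₂ := by
  funext p
  obtain ⟨φ, hφ⟩ := exists_seq_schwartz_tendsto_mass p
  refine tendsto_nhds_unique (hφ c₁ h₁) ?_
  simpa only [h] using hφ c₂ h₂

/-- A quasicrystal is determined by its Fourier transform. -/
theorem FQC.c_eq_of_b_eq {d : ℕ} {μ ν : FQC d} (h : μ.b = ν.b) : μ.c = ν.c := by
  refine masses_eq_of_forall_tsum_eq μ.tempAbs ν.tempAbs fun ψ => ?_
  have hψ : SchwartzMap.fourierTransformCLM ℂ (𝓕⁻ ψ) = ψ :=
    (SchwartzMap.fourierTransformCLM_apply ℂ _).trans (FourierTransform.fourier_fourierInv_eq ψ)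
  rw [← μ.temp, ← ν.temp, ← hψ, μ.hatT, ν.hatT, h]

/-- Among `N + 1` concentric annuli in a ball of radius at most `1` with at most `N` points,
one contains no point. -/
theorem exists_empty_annulus {d N : ℕ} {S : Set (Ed d)} {y : Ed d}
    (hS : (S ∩ ball y 1).encard ≤ N) {r : ℝ} (hr : (N + 2) * r ≤ 1) :
    ∃ j ∈ Finset.range (N + 1), ∀ x ∈ S,
      dist x y < (j + 1) * r ∨ (j + 2) * r ≤ dist x y := by
  by_contra! hcon
  choose! f hfS hf1 hf2 using hcon
  have hr0 : 0 < r := by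
    have h1 := hf1 0 (by simp)
    have h2 := hf2 0 (by simp)
    push_cast at h1 h2
    linarith
  have hinj : Set.InjOn f (Finset.range (N + 1) : Finset ℕ) := by
    have key : ∀ i ∈ Finset.range (N + 1), ∀ j ∈ Finset.range (N + 1), f i = f j → i ≤ j := by
      intro i hi j hj hij
      by_contra! hlt
      have hlt' : (j : ℝ) + 1 ≤ i := by exact_mod_cast hlt
      have h1 := hf1 i hi
      have h2 := hf2 j hj
      rw [hij] at h1
      nlinarith
    intro i hi j hj hij
    exact le_antisymm (key i hi j hj hij) (key j hj i hi hij.symm)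
  have hsub : f '' (Finset.range (N + 1) : Finset ℕ) ⊆ S ∩ ball y 1 := by
    rintro _ ⟨j, hj, rfl⟩
    refine ⟨hfS j hj, ?_⟩
    have hjN : (j : ℝ) ≤ N := by
      exact_mod_cast Nat.lt_succ_iff.1 (Finset.mem_range.1 hj)
    rw [mem_ball]
    have := hf2 j hj
    nlinarith
  have h1 := (Set.encard_le_encard hsub).trans hS
  rw [hinj.encard_image, Set.encard_coe_eq_coe_finsetCard, Finset.card_range] at h1
  have h2 : N + 1 ≤ N := by exact_mod_cast h1
  omega

theorem exists_isolating_radius {d N : ℕ} {S : Set (Ed d)} {p : Ed d}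
    (hS : (S ∩ ball p 1).encard ≤ N) :
    ∃ r > (0 : ℝ), ∀ s ≤ r, ∀ x ∈ S, dist x p < s → x = p := by
  have hfin : (S ∩ ball p 1).Finite :=
    Set.finite_of_encard_le_coe hS
  have hnhds : ((S ∩ ball p 1) \ {p})ᶜ ∈ 𝓝 p :=
    (hfin.subset Set.sdiff_subset).isClosed.isOpen_compl.mem_nhds (by simp)
  obtain ⟨ε, hε, hsub⟩ := Metric.mem_nhds_iff.1 hnhds
  refine ⟨min ε 1, lt_min hε one_pos, fun s hs x hx hxp => ?_⟩
  by_contra hne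
  have hlt := hxp.trans_le hs
  exact hsub (mem_ball.2 (hlt.trans_le (min_le_left _ _)))
    ⟨⟨hx, mem_ball.2 (hlt.trans_le (min_le_right _ _))⟩, hne⟩

theorem tsum_mul_eq_mass {d : ℕ} {b : Ed d → ℂ} {p : Ed d} {r : ℝ} {φ : 𝓢(Ed d, ℂ)}
    (hb : ∀ x ∈ Function.support b, dist x p < r → x = p) (h1 : φ p = 1)
    (h0 : ∀ x, r ≤ dist x p → φ x = 0) : ∑' x : Ed d, b x * φ x = b p := by
  rw [tsum_eq_single p, h1, mul_one]
  intro x hx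
  by_cases hbx : b x = 0
  · rw [hbx, zero_mul]
  · rw [h0 x (not_lt.1 fun hlt => hx (hb x hbx hlt)), mul_zero]

/-- If `φ` takes the same values at corresponding points of two enumerated discrete measures,
vanishes outside a set of at most `N` of them, and the corresponding masses there are `ε`-close,
then the two measures are `N * ε`-close on `φ`. -/
theorem norm_tsum_sub_tsum_le {d N : ℕ} {b₁ b₂ φ : Ed d → ℂ} {l g : ℕ → Ed d} {B : Set (Ed d)}
    {ε : ℝ} (hε : 0 ≤ ε)
    (hl : Function.Injective l) (hg : Function.Injective g)
    (hrl : Set.range l = Function.support b₁) (hrg : Set.range g = Function.support b₂)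
    (h₁ : Summable fun x => b₁ x * φ x) (h₂ : Summable fun x => b₂ x * φ x)
    (hB : (Function.support b₁ ∩ B).encard ≤ N)
    (hφ : ∀ n, φ (l n) = φ (g n)) (hφ0 : ∀ n, l n ∉ B → φ (l n) = 0) (hφ1 : ∀ x, ‖φ x‖ ≤ 1)
    (hclose : ∀ n, l n ∈ B → ‖b₁ (l n) - b₂ (g n)‖ ≤ ε) :
    ‖∑' x, b₁ x * φ x - ∑' x, b₂ x * φ x‖ ≤ N * ε := by
  have s₁ : Function.support (fun x => b₁ x * φ x) ⊆ Set.range l := by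
    rw [hrl]
    exact fun x hx => left_ne_zero_of_mul hx
  have s₂ : Function.support (fun x => b₂ x * φ x) ⊆ Set.range g := by
    rw [hrg]
    exact fun x hx => left_ne_zero_of_mul hx
  have hcard : (l ⁻¹' B).encard ≤ N := by
    rw [← hl.encard_image, Set.image_preimage_eq_inter_range, Set.inter_comm, hrl]
    exact hB
  have hfin : (l ⁻¹' B).Finite := Set.finite_of_encard_le_coe hcard
  rw [← hl.tsum_eq s₁, ← hg.tsum_eq s₂,
    ← Summable.tsum_sub (f := fun n => b₁ (l n) * φ (l n)) (g := fun n => b₂ (g n) * φ (g n))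
      (h₁.comp_injective hl) (h₂.comp_injective hg),
    tsum_eq_sum (s := hfin.toFinset)]
  · refine (norm_sum_le_of_le (f := fun n => b₁ (l n) * φ (l n) - b₂ (g n) * φ (g n)) _
      (n := fun _ => ε) fun n hn => ?_).trans ?_
    · rw [← hφ n, ← sub_mul, norm_mul]
      have h := hclose n (by simpa using hn)
      calc _ ≤ ε * 1 := mul_le_mul h (hφ1 _) (norm_nonneg _) hε
        _ = ε := mul_one ε
    · rw [Finset.sum_const, nsmul_eq_mul]
      gcongr
      rw [hfin.encard_eq_coe_toFinset_card] at hcard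
      exact_mod_cast hcard
  · intro n hn
    have h0 := hφ0 n (by simpa using hn)
    simp [← hφ n, h0]

theorem eventually_forall_one_le_dist_sub_nsmul {d : ℕ} {v : Ed d} (hv : v ≠ 0) (p : Ed d)
    (l : ℕ → Ed d) (n₀ : ℕ) :
    ∀ᶠ k : ℕ in atTop, ∀ n < n₀, 1 ≤ dist (l n - k • v) p := by
  have h : ∀ n, ∀ᶠ k : ℕ in atTop, 1 ≤ dist (l n - k • v) p := by
    intro n
    have ht : Tendsto (fun k : ℕ => (k : ℝ) * ‖v‖ - dist (l n) p) atTop atTop :=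
      tendsto_atTop_add_const_right _ _
        (tendsto_natCast_atTop_atTop.atTop_mul_const (norm_pos_iff.2 hv))
    filter_upwards [ht.eventually_ge_atTop 1] with k hk
    refine hk.trans ?_
    have h1 : ‖(k : ℕ) • v‖ = k * ‖v‖ := by
      rw [← Nat.cast_smul_eq_nsmul ℝ, norm_smul, Real.norm_natCast]
    rw [← h1, dist_eq_norm, dist_eq_norm, sub_right_comm, norm_sub_rev _ (k • v)]
    exact norm_sub_norm_le _ _
  filter_upwards [(Finset.range n₀).eventually_all.2 fun n _ => h n] with k hk n hn
  exact hk n (Finset.mem_range.2 hn)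

theorem FQC.eventually_dist_translate_lt {d N : ℕ} (κ : FQC d) {v p : Ed d} {F : Filter ℕ}
    (hF : ∀ x : Ed d, Tendsto (fun k : ℕ => (𝐞 ⟪v, x⟫) ^ k) F (𝓝 (1 : Circle))) {ρ : ℝ}
    (hiso : ∀ x ∈ Function.support κ.b, dist x p < ρ → x = p) {φ : ℕ → 𝓢(Ed d, ℂ)}
    (hφ1 : ∀ j, φ j p = 1)
    (hφ0 : ∀ j ∈ Finset.range (N + 1), ∀ x, ρ ≤ dist x p → φ j x = 0) {ε : ℝ} (hε : 0 < ε) :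
    ∀ᶠ k in F, ∀ j ∈ Finset.range (N + 1),
      dist (∑' y : Ed d, κ.b y * φ j (y - k • v)) (κ.b p) < ε := by
  refine (Finset.range (N + 1)).eventually_all.2 fun j hj => ?_
  have h := κ.tendsto_tsum_translate v hF (φ j)
  rw [tsum_mul_eq_mass hiso (hφ1 j) (hφ0 j hj)] at h
  exact Metric.tendsto_nhds.1 h ε hε

/-- Comparison of two discrete measures on a translated bump, provided that no point of the first
one lies in the translated transition annulus. -/
theorem norm_tsum_translate_sub_le {d N : ℕ} {b₁ b₂ : Ed d → ℂ} {l g : ℕ → Ed d} {p τ : Ed d}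
    {φ : 𝓢(Ed d, ℂ)} {n₀ : ℕ} {ε α β δ : ℝ} (hε : 0 ≤ ε) (hδ : 0 < δ) (hβ : β ≤ 1)
    (hl : Function.Injective l) (hg : Function.Injective g)
    (hrl : Set.range l = Function.support b₁) (hrg : Set.range g = Function.support b₂)
    (h₁ : Summable fun x => b₁ x * φ (x - τ)) (h₂ : Summable fun x => b₂ x * φ (x - τ))
    (hB : (Function.support b₁ ∩ ball (p + τ) 1).encard ≤ N)
    (hφ1 : ∀ x, dist x p ≤ α + δ → φ x = 1) (hφ0 : ∀ x, β - δ ≤ dist x p → φ x = 0)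
    (hφle : ∀ x, ‖φ x‖ ≤ 1)
    (hann : ∀ x ∈ Function.support b₁, dist x (p + τ) < α ∨ β ≤ dist x (p + τ))
    (hpts : ∀ n ≥ n₀, ‖l n - g n‖ < δ) (hmass : ∀ n ≥ n₀, ‖b₁ (l n) - b₂ (g n)‖ < ε)
    (hkl : ∀ n < n₀, 1 ≤ dist (l n - τ) p) (hkg : ∀ n < n₀, 1 ≤ dist (g n - τ) p) :
    ‖∑' x, b₁ x * φ (x - τ) - ∑' x, b₂ x * φ (x - τ)‖ ≤ N * ε := by
  have hdist : ∀ x : Ed d, dist x (p + τ) = dist (x - τ) p := by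
    intro x
    rw [dist_eq_norm, dist_eq_norm, sub_sub, add_comm]
  have hφ0' : ∀ x, 1 ≤ dist x p → φ x = 0 := fun x hx => hφ0 x (by linarith)
  refine norm_tsum_sub_tsum_le (φ := fun y => φ (y - τ)) hε hl hg hrl hrg h₁ h₂ hB
    (fun n => ?_) (fun n hn => ?_) (fun x => hφle _) (fun n hn => ?_)
  · rcases lt_or_ge n n₀ with hn | hn
    · rw [hφ0' _ (hkl n hn), hφ0' _ (hkg n hn)]
    · have hlg : dist (l n - τ) (g n - τ) < δ := by
        rw [dist_sub_right, dist_eq_norm]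
        exact hpts n hn
      have t1 := dist_triangle (l n - τ) (g n - τ) p
      have t2 := dist_triangle_left (g n - τ) p (l n - τ)
      have hlS : l n ∈ Function.support b₁ := hrl ▸ Set.mem_range_self n
      rcases hann (l n) hlS with h | h
      · rw [hdist] at h
        rw [hφ1 (l n - τ) (by linarith), hφ1 (g n - τ) (by linarith)]
      · rw [hdist] at h
        rw [hφ0 (l n - τ) (by linarith), hφ0 (g n - τ) (by linarith)]
  · rw [mem_ball, hdist, not_lt] at hn
    exact hφ0' _ hn
  · rw [mem_ball, hdist] at hn
    exact (hmass n (not_lt.1 fun hlt => absurd (hkl n hlt) (not_le.2 hn))).le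

theorem FQC.b_eq_of_tendsto {d : ℕ} (μ ν : FQC d)
    (hsparseμ : ∃ N : ℕ, ∀ y : Ed d, (Function.support μ.b ∩ Metric.ball y 1).encard ≤ N)
    (hsparseν : ∃ N : ℕ, ∀ y : Ed d, (Function.support ν.b ∩ Metric.ball y 1).encard ≤ N)
    (l g : ℕ → Ed d)
    (hl : Function.Injective l) (hg : Function.Injective g)
    (hrl : Set.range l = Function.support μ.b) (hrg : Set.range g = Function.support ν.b)
    (hpts : Tendsto (fun n => l n - g n) atTop (𝓝 0))
    (hmass : Tendsto (fun n => μ.b (l n) - ν.b (g n)) atTop (𝓝 0)) :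
    μ.b = ν.b := by
  obtain ⟨N, hN⟩ := hsparseμ
  obtain ⟨N', hN'⟩ := hsparseν
  obtain ⟨v, hv⟩ : ∃ v : Ed d, v ≠ 0 := ⟨l 1 - l 0, sub_ne_zero.2 (hl.ne one_ne_zero)⟩
  obtain ⟨F, hFne, hF, hchar⟩ := exists_filter_tendsto_fourierChar_pow v
  funext p
  obtain ⟨r₁, hr₁, hiso₁⟩ := exists_isolating_radius (hN p)
  obtain ⟨r₂, hr₂, hiso₂⟩ := exists_isolating_radius (hN' p)
  obtain ⟨r, hr, hr1, hrr₁, hrr₂⟩ : ∃ r > (0 : ℝ), (N + 2) * r ≤ 1 ∧ (N + 2) * r ≤ r₁ ∧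
      (N + 2) * r ≤ r₂ := by
    have hN2 : (0 : ℝ) < N + 2 := by positivity
    refine ⟨min 1 (min r₁ r₂) / (N + 2), by positivity, ?_⟩
    rw [mul_div_cancel₀ _ hN2.ne']
    simp
  choose φ hφ1 hφ0 hφle using fun j : ℕ =>
    exists_schwartz_bump p (a := (j + 1) * r + r / 3) (b := (j + 2) * r - r / 3)
      (by positivity) (by linarith)
  have hjN : ∀ j ∈ Finset.range (N + 1), (j + 2) * r ≤ (N + 2) * r := by
    intro j hj
    have : (j : ℝ) ≤ N := by exact_mod_cast Nat.lt_succ_iff.1 (Finset.mem_range.1 hj)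
    gcongr
  have hφp : ∀ j, φ j p = 1 := fun j => hφ1 j p (by rw [dist_self]; positivity)
  have hφfar : ∀ j ∈ Finset.range (N + 1), ∀ x, (N + 2) * r ≤ dist x p → φ j x = 0 :=
    fun j hj x hx => hφ0 j x (by linarith [hjN j hj])
  refine eq_of_forall_dist_le fun ε hε => ?_
  have hδ : 0 < ε / (3 * (N + 1)) := by positivity
  obtain ⟨n₀, hn₀⟩ := eventually_atTop.1
    ((Metric.tendsto_nhds.1 hpts (r / 3) (by positivity)).and (Metric.tendsto_nhds.1 hmass _ hδ))
  simp only [dist_zero_right] at hn₀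
  have ev₁ := μ.eventually_dist_translate_lt hchar (hiso₁ _ hrr₁) hφp hφfar (div_pos hε three_pos)
  have ev₂ := ν.eventually_dist_translate_lt hchar (hiso₂ _ hrr₂) hφp hφfar (div_pos hε three_pos)
  have ev₃ := hF ((eventually_forall_one_le_dist_sub_nsmul hv p l n₀).and
    (eventually_forall_one_le_dist_sub_nsmul hv p g n₀))
  obtain ⟨k, ⟨hk₁, hk₂⟩, hkl, hkg⟩ := ((ev₁.and ev₂).and ev₃).exists
  obtain ⟨j, hj, hann⟩ := exists_empty_annulus (hN (p + k • v)) hr1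
  have hclose := norm_tsum_translate_sub_le hδ.le (by positivity) ((hjN j hj).trans hr1)
    hl hg hrl hrg
    (μ.summable_b_mul_translate (φ j) (k • v)) (ν.summable_b_mul_translate (φ j) (k • v))
    (hN (p + k • v)) (hφ1 j) (hφ0 j) (hφle j) hann (fun n hn => (hn₀ n hn).1)
    (fun n hn => (hn₀ n hn).2) hkl hkg
  have hNε : N * (ε / (3 * (N + 1))) ≤ ε / 3 := by
    rw [mul_div_assoc', div_le_div_iff₀ (by positivity) (by positivity)]
    nlinarith
  rw [← dist_eq_norm] at hclose
  have t := dist_triangle4 (μ.b p) (∑' y : Ed d, μ.b y * φ j (y - k • v))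
    (∑' y : Ed d, ν.b y * φ j (y - k • v)) (ν.b p)
  linarith [hk₁ j hj, hk₂ j hj, dist_comm (μ.b p) (∑' y : Ed d, μ.b y * φ j (y - k • v))]

/-- Uniqueness via spectra (Theorem 5 of the paper): two Fourier quasicrystals with uniformly
sparse spectra whose spectra and Fourier masses approach each other at infinity coincide. -/
theorem FQC_unique_via_spectra {d : ℕ} (μ ν : FQC d)
    (hsparseμ : ∃ N : ℕ, ∀ y : Ed d, (Function.support μ.b ∩ Metric.ball y 1).encard ≤ N)
    (hsparseν : ∃ N : ℕ, ∀ y : Ed d, (Function.support ν.b ∩ Metric.ball y 1).encard ≤ N)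
    (l g : ℕ → Ed d)
    (hl : Function.Injective l) (hg : Function.Injective g)
    (hrl : Set.range l = Function.support μ.b) (hrg : Set.range g = Function.support ν.b)
    (hpts : Tendsto (fun n => l n - g n) atTop (𝓝 0))
    (hmass : Tendsto (fun n => μ.b (l n) - ν.b (g n)) atTop (𝓝 0)) :
    μ.c = ν.c := by
  exact FQC.c_eq_of_b_eq
    (FQC.b_eq_of_tendsto μ ν hsparseμ hsparseν l g hl hg hrl hrg hpts hmass)
end
end
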